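/- If gcd(m, q−1) = 1, then D(q; m, n) is isomorphic to D(q; 1, n′) for some integer n′ satisfying m·n′ ≡ n (mod q−1). -/

import Mathlib

/-- The arc relation of the monomial digraph `D(q; m, n)`. -/
def monArc {F : Type*} [Field F] (m n : ℕ) (u v : F × F) : Prop :=
  u.2 + v.2 = u.1 ^ m * v.1 ^ n

/-- Powers in a finite field depend only on the residue of a nonzero exponent. -/
theorem FiniteField.pow_eq_pow_of_modEq_card_sub_one {F : Type*} [Field F] [Fintype F]
    {a b : ℕ} (ha : a ≠ 0) (hb : b ≠ 0) (h : a ≡ b [MOD Fintype.card F - 1]) (x : F) :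
    x ^ a = x ^ b := by
  rcases eq_or_ne x 0 with rfl | hx
  · rw [zero_pow ha, zero_pow hb]
  · exact pow_eq_pow_of_modEq h (FiniteField.pow_card_sub_one_eq_one x hx)

/-- A number coprime to `N` has a positive inverse modulo `N`. -/
theorem Nat.exists_pos_mul_modEq_one_of_coprime {m N : ℕ} (hN : 0 < N) (h : m.Coprime N) :
    ∃ k, 0 < k ∧ m * k ≡ 1 [MOD N] := by
  obtain ⟨y, hy⟩ := Int.mod_coprime h
  refine ⟨(y % N).toNat + N, by omega, ?_⟩
  rw [← Int.natCast_modEq_iff]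
  push_cast
  rw [Int.toNat_of_nonneg (Int.emod_nonneg _ (by omega))]
  refine Int.ModEq.trans (Int.ModEq.mul_left _ ?_) hy
  simp [Int.ModEq]

/-- If `gcd(m, q−1) = 1`, then `D(q; m, n)` is isomorphic to `D(q; 1, n')`
for some `n'` with `m n' ≡ n (mod q−1)`. -/
theorem stmt_3 {F : Type*} [Field F] [Fintype F] (q : ℕ) (hq : Fintype.card F = q)
    (m n : ℕ) (hm : 1 ≤ m ∧ m ≤ q - 1) (hn : 1 ≤ n ∧ n ≤ q - 1)
    (hgcd : Nat.gcd m (q - 1) = 1) :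
    ∃ n' : ℕ, m * n' ≡ n [MOD q - 1] ∧
      ∃ φ : (F × F) ≃ (F × F),
        ∀ u v : F × F, monArc m n u v ↔ monArc 1 n' (φ u) (φ v) := by
  subst hq
  obtain ⟨k, hk, hmk⟩ := Nat.exists_pos_mul_modEq_one_of_coprime (by omega) hgcd
  have hm0 : m ≠ 0 := by omega
  have hn0 : n ≠ 0 := by omega
  have hmn : m * (k * n) ≡ n [MOD Fintype.card F - 1] := by
    simpa [mul_assoc] using hmk.mul_right n
  have hpow (x : F) : x ^ (m * k) = x := by
    simpa using FiniteField.pow_eq_pow_of_modEq_card_sub_one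
      (mul_ne_zero hm0 hk.ne') one_ne_zero hmk x
  let powEquiv : F ≃ F :=
    { toFun x := x ^ m
      invFun x := x ^ k
      left_inv x := by simp only [← pow_mul, hpow]
      right_inv x := by simp only [← pow_mul, mul_comm k m, hpow] }
  refine ⟨k * n, hmn, powEquiv.prodCongr (Equiv.refl F), fun u v => ?_⟩
  have hv : (v.1 ^ m) ^ (k * n) = v.1 ^ n := by
    rw [← pow_mul]
    exact FiniteField.pow_eq_pow_of_modEq_card_sub_one
      (mul_ne_zero hm0 (mul_ne_zero hk.ne' hn0)) hn0 hmn v.1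
  simp [monArc, powEquiv, hv]
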